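/- Let X be a finite alphabet and Ψ = {S_j : X* → ℝ^p | j ∈ J} an indexed family of formal power series. Then Ψ admits a rational representation if and only if the linear span of the columns of the Hankel matrix H_Ψ is finite-dimensional. -/

import Mathlib

open Matrix

section PowerSeriesDefs

variable {X J : Type*} {p n : ℕ}

/-- `A_w = A_{σ_k} ⋯ A_{σ_1}` for the word `w = σ_1 ⋯ σ_k`. -/
def wordProd {n : ℕ} (A : X → Matrix (Fin n) (Fin n) ℝ) : List X → Matrix (Fin n) (Fin n) ℝ
  | [] => 1
  | σ :: w => wordProd A w * A σ

/-- Column of the full Hankel matrix of the family `S`, indexed by `(w, j)`. -/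
def hankelCol (S : J → List X → Fin p → ℝ) (w : List X) (j : J) : List X × Fin p → ℝ :=
  fun vi => S j (w ++ vi.1) vi.2

/-- Linear span of the columns of the full Hankel matrix `H_Ψ`. -/
def fullHankelSpan (S : J → List X → Fin p → ℝ) : Submodule ℝ (List X × Fin p → ℝ) :=
  Submodule.span ℝ (Set.range fun wj : List X × J => hankelCol S wj.1 wj.2)

/-- Column of the sub-Hankel matrix `H_{Ψ,M,K}` (rows restricted to `|v| ≤ M`). -/
def hankelColTrunc (S : J → List X → Fin p → ℝ) (M : ℕ) (w : List X) (j : J) :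
    {v : List X // v.length ≤ M} × Fin p → ℝ :=
  fun vi => S j (w ++ vi.1.1) vi.2

/-- `rank H_{Ψ,M,K}` : dimension of the span of the columns of the sub-Hankel matrix
whose rows are indexed by `(v,i)` with `|v| ≤ M` and whose columns are indexed by
`(w,j)` with `|w| ≤ K`. -/
noncomputable def hankelRank (S : J → List X → Fin p → ℝ) (M K : ℕ) : ℕ :=
  Module.finrank ℝ (Submodule.span ℝ
    (Set.range fun wj : {w : List X // w.length ≤ K} × J =>
      hankelColTrunc S M wj.1.1 wj.2))

/-- `R = (ℝⁿ, {A_σ}, B, C)` is an `N`-partial representation of the family `S`. -/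
def IsPartialRep (S : J → List X → Fin p → ℝ) (N : ℕ)
    (A : X → Matrix (Fin n) (Fin n) ℝ) (B : J → Fin n → ℝ)
    (C : Matrix (Fin p) (Fin n) ℝ) : Prop :=
  ∀ (j : J) (w : List X), w.length ≤ N → S j w = C.mulVec ((wordProd A w).mulVec (B j))

/-- `R = (ℝⁿ, {A_σ}, B, C)` is a (complete) representation of the family `S`. -/
def IsRep (S : J → List X → Fin p → ℝ)
    (A : X → Matrix (Fin n) (Fin n) ℝ) (B : J → Fin n → ℝ)
    (C : Matrix (Fin p) (Fin n) ℝ) : Prop :=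
  ∀ (j : J) (w : List X), S j w = C.mulVec ((wordProd A w).mulVec (B j))

/-- Reachability: the span of the vectors `A_w B_j` is the whole state space. -/
def IsReachable (A : X → Matrix (Fin n) (Fin n) ℝ) (B : J → Fin n → ℝ) : Prop :=
  Submodule.span ℝ
    {x : Fin n → ℝ | ∃ (w : List X) (j : J), x = (wordProd A w).mulVec (B j)} = ⊤

/-- Observability: the intersection of the kernels of the maps `C A_w` is trivial. -/
def IsObservable (A : X → Matrix (Fin n) (Fin n) ℝ)
    (C : Matrix (Fin p) (Fin n) ℝ) : Prop :=
  ∀ x : Fin n → ℝ, (∀ w : List X, C.mulVec ((wordProd A w).mulVec x) = 0) → x = 0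

end PowerSeriesDefs

section HankelRealization

variable {X J : Type*} {p n : ℕ}

theorem wordProd_append (A : X → Matrix (Fin n) (Fin n) ℝ) (w v : List X) :
    wordProd A (w ++ v) = wordProd A v * wordProd A w := by
  induction w with
  | nil => simp [wordProd]
  | cons σ w ih => simp [wordProd, ih, Matrix.mul_assoc]

/-- The observability map `x ↦ ((v, i) ↦ (C A_v x)_i)`. -/
def observabilityMap (A : X → Matrix (Fin n) (Fin n) ℝ) (C : Matrix (Fin p) (Fin n) ℝ) :
    (Fin n → ℝ) →ₗ[ℝ] (List X × Fin p → ℝ) :=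
  LinearMap.pi fun vi => LinearMap.proj vi.2 ∘ₗ (C * wordProd A vi.1).mulVecLin

theorem fullHankelSpan_le_range_observabilityMap {S : J → List X → Fin p → ℝ}
    {A : X → Matrix (Fin n) (Fin n) ℝ} {B : J → Fin n → ℝ} {C : Matrix (Fin p) (Fin n) ℝ}
    (h : IsRep S A B C) : fullHankelSpan S ≤ LinearMap.range (observabilityMap A C) := by
  refine Submodule.span_le.2 ?_
  rintro _ ⟨⟨w, j⟩, rfl⟩
  refine ⟨wordProd A w *ᵥ B j, ?_⟩
  ext ⟨v, i⟩
  simp [observabilityMap, hankelCol, h j (w ++ v), wordProd_append, Matrix.mulVec_mulVec]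

/-- The left shift `(T_σ f) (v, i) = f (σ v, i)`. -/
def wordShift (p : ℕ) (σ : X) : (List X × Fin p → ℝ) →ₗ[ℝ] (List X × Fin p → ℝ) :=
  LinearMap.funLeft ℝ ℝ fun vi => (σ :: vi.1, vi.2)

theorem hankelCol_mem_fullHankelSpan (S : J → List X → Fin p → ℝ) (w : List X) (j : J) :
    hankelCol S w j ∈ fullHankelSpan S :=
  Submodule.subset_span ⟨(w, j), rfl⟩

theorem wordShift_hankelCol (S : J → List X → Fin p → ℝ) (σ : X) (w : List X) (j : J) :
    wordShift p σ (hankelCol S w j) = hankelCol S (w ++ [σ]) j := by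
  ext ⟨v, i⟩
  simp [wordShift, hankelCol, LinearMap.funLeft_apply]

theorem wordShift_mem_fullHankelSpan (S : J → List X → Fin p → ℝ) (σ : X) :
    ∀ f ∈ fullHankelSpan S, wordShift p σ f ∈ fullHankelSpan S := by
  suffices h : fullHankelSpan S ≤ (fullHankelSpan S).comap (wordShift p σ) from h
  refine Submodule.span_le.2 ?_
  rintro _ ⟨⟨w, j⟩, rfl⟩
  change wordShift p σ (hankelCol S w j) ∈ fullHankelSpan S
  rw [wordShift_hankelCol]
  exact hankelCol_mem_fullHankelSpan S _ j

/-- A shift-invariant space of functions with a finite basis is realized by the matrices of the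
shifts and of the evaluation at the empty word. -/
theorem mulVec_wordProd_toMatrix_wordShift (V : Submodule ℝ (List X × Fin p → ℝ))
    (hV : ∀ σ, ∀ f ∈ V, wordShift p σ f ∈ V) (b : Module.Basis (Fin n) ℝ V) (w : List X) (f : V) :
    LinearMap.toMatrix b (Pi.basisFun ℝ (Fin p))
        (LinearMap.funLeft ℝ ℝ (fun i : Fin p => (([] : List X), i)) ∘ₗ V.subtype) *ᵥ
      (wordProd (fun σ => LinearMap.toMatrix b b ((wordShift p σ).restrict (hV σ))) w *ᵥ
        b.repr f) = fun i => (f : List X × Fin p → ℝ) (w, i) := by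
  induction w generalizing f with
  | nil =>
    ext i
    simp [wordProd, LinearMap.toMatrix_mulVec_repr, LinearMap.funLeft_apply]
  | cons σ w ih =>
    rw [wordProd, ← Matrix.mulVec_mulVec, LinearMap.toMatrix_mulVec_repr, ih]
    rfl

end HankelRealization

/-- `Ψ` admits a rational representation if and only if the linear span of
the columns of its Hankel matrix `H_Ψ` is finite-dimensional. -/
theorem stmt7 {X J : Type*} [Fintype X] {p : ℕ} (S : J → List X → Fin p → ℝ) :
    (∃ (n : ℕ) (A : X → Matrix (Fin n) (Fin n) ℝ) (B : J → Fin n → ℝ)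
       (C : Matrix (Fin p) (Fin n) ℝ), IsRep S A B C) ↔
    FiniteDimensional ℝ (fullHankelSpan S) := by
  constructor
  · rintro ⟨n, A, B, C, h⟩
    exact Submodule.finiteDimensional_of_le (fullHankelSpan_le_range_observabilityMap h)
  · intro _
    let b := Module.finBasis ℝ (fullHankelSpan S)
    exact ⟨_, _, fun j => b.repr ⟨_, hankelCol_mem_fullHankelSpan S [] j⟩, _, fun j w =>
      (mulVec_wordProd_toMatrix_wordShift (fullHankelSpan S)
        (wordShift_mem_fullHankelSpan S) b w ⟨_, hankelCol_mem_fullHankelSpan S [] j⟩).symm⟩
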